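/- arXiv:2107.00909 — 12 statements merged into one kernel-verified Lean document; each statement's English description precedes it below -/
import Mathlib

section
/- Let A be the 2×2 real matrix A = [[(1 + u_ch/u_cc)·φ + ρ, (u_ch² − u_cc·u_hh)/u_cc], [−φ²/u_cc, −φ·(1 + u_ch/u_cc)]] with φ > 0, ρ > 0 and u_cc < 0, u_hh < 0, u_ch real. If u_ch < −[(φ+ρ)·u_cc + φ·u_hh]/(ρ+2φ), then the characteristic polynomial of A has two distinct real roots ψ₁ < 0 < ψ₂, given by ψ_{1,2} = (ρ ∓ √(ρ² − 4·det A))/2 with ρ² − 4·det A > 0. -/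
open Polynomial

/-- The matrix governing the linearized habit–costate dynamics. -/
noncomputable def lockdownMatrix (φ ρ ucc uhh uch : ℝ) : Matrix (Fin 2) (Fin 2) ℝ :=
  !![(1 + uch / ucc) * φ + ρ, (uch ^ 2 - ucc * uhh) / ucc;
     -(φ ^ 2) / ucc, -(φ * (1 + uch / ucc))]

/-- If `u_ch` is below the threshold, the characteristic polynomial of the linearized
dynamics matrix has two distinct real roots of opposite sign,
`ψ_{1,2} = (ρ ∓ √(ρ² − 4 det A))/2` with positive discriminant. -/
theorem lockdownMatrix_saddle
    (φ ρ ucc uhh uch : ℝ) (hφ : 0 < φ) (hρ : 0 < ρ) (hucc : ucc < 0) (huhh : uhh < 0)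
    (huch : uch < -(((φ + ρ) * ucc + φ * uhh) / (ρ + 2 * φ))) :
    0 < ρ ^ 2 - 4 * (lockdownMatrix φ ρ ucc uhh uch).det ∧
    (ρ - Real.sqrt (ρ ^ 2 - 4 * (lockdownMatrix φ ρ ucc uhh uch).det)) / 2 < 0 ∧
    0 < (ρ + Real.sqrt (ρ ^ 2 - 4 * (lockdownMatrix φ ρ ucc uhh uch).det)) / 2 ∧
    (ρ - Real.sqrt (ρ ^ 2 - 4 * (lockdownMatrix φ ρ ucc uhh uch).det)) / 2
      ≠ (ρ + Real.sqrt (ρ ^ 2 - 4 * (lockdownMatrix φ ρ ucc uhh uch).det)) / 2 ∧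
    (lockdownMatrix φ ρ ucc uhh uch).charpoly.IsRoot
      ((ρ - Real.sqrt (ρ ^ 2 - 4 * (lockdownMatrix φ ρ ucc uhh uch).det)) / 2) ∧
    (lockdownMatrix φ ρ ucc uhh uch).charpoly.IsRoot
      ((ρ + Real.sqrt (ρ ^ 2 - 4 * (lockdownMatrix φ ρ ucc uhh uch).det)) / 2) := by
  have hdet : (lockdownMatrix φ ρ ucc uhh uch).det
      = -(φ / ucc) * ((φ + ρ) * ucc + (ρ + 2 * φ) * uch + φ * uhh) := by
    have hne : ucc ≠ 0 := hucc.ne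
    rw [lockdownMatrix, Matrix.det_fin_two_of]
    field_simp
    ring
  have htr : (lockdownMatrix φ ρ ucc uhh uch).trace = ρ := by
    rw [lockdownMatrix, Matrix.trace_fin_two_of]
    ring
  have hneg : (lockdownMatrix φ ρ ucc uhh uch).det < 0 := by
    rw [hdet]
    have h1 : 0 < ρ + 2 * φ := by positivity
    rw [← neg_div, lt_div_iff₀ h1] at huch
    have h2 : φ / ucc < 0 := div_neg_of_pos_of_neg hφ hucc
    exact mul_neg_of_pos_of_neg (by linarith) (by linarith)
  have hcp := Matrix.charpoly_fin_two (lockdownMatrix φ ρ ucc uhh uch)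
  rw [htr] at hcp
  rw [hcp]
  generalize (lockdownMatrix φ ρ ucc uhh uch).det = d at hneg
  have hD : 0 < ρ ^ 2 - 4 * d := by nlinarith [sq_nonneg ρ]
  have hs := Real.sq_sqrt hD.le
  have hlt : ρ < Real.sqrt (ρ ^ 2 - 4 * d) := Real.lt_sqrt_of_sq_lt (by linarith)
  refine ⟨hD, by linarith, by linarith, fun h => by linarith, ?_, ?_⟩ <;>
  · simp only [Polynomial.IsRoot.def, eval_add, eval_sub, eval_mul, eval_pow, eval_X, eval_C]
    linarith
end

section
/- Let A be the 2×2 real matrix A = [[(1 + u_ch/u_cc)·φ + ρ, (u_ch² − u_cc·u_hh)/u_cc], [−φ²/u_cc, −φ·(1 + u_ch/u_cc)]] with φ > 0, ρ > 0 and u_cc < 0, u_hh < 0, u_ch real. If −[(φ+ρ)·u_cc + φ·u_hh]/(ρ+2φ) < u_ch < −ρ²·u_cc/(4φ·(ρ+2φ)) − [(φ+ρ)·u_cc + φ·u_hh]/(ρ+2φ), then the characteristic polynomial of A has two real roots and both roots are strictly positive. -/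
open Polynomial

/-- If `u_ch` lies strictly between the two thresholds, the characteristic polynomial of
the linearized dynamics matrix has two real roots, both strictly positive. -/
theorem lockdownMatrix_two_positive_real_roots
    (φ ρ ucc uhh uch : ℝ) (hφ : 0 < φ) (hρ : 0 < ρ) (hucc : ucc < 0) (huhh : uhh < 0)
    (huch_lo : -(((φ + ρ) * ucc + φ * uhh) / (ρ + 2 * φ)) < uch)
    (huch_hi : uch < -(ρ ^ 2 * ucc) / (4 * φ * (ρ + 2 * φ))
        - ((φ + ρ) * ucc + φ * uhh) / (ρ + 2 * φ)) :
    ∃ ψ₁ ψ₂ : ℝ,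
      (lockdownMatrix φ ρ ucc uhh uch).charpoly = (X - C ψ₁) * (X - C ψ₂) ∧
      0 < ψ₁ ∧ 0 < ψ₂ := by
  have hp : 0 < ρ + 2 * φ := by positivity
  have hne : ucc ≠ 0 := hucc.ne
  obtain ⟨S, hS⟩ : ∃ S, S = (φ + ρ) * ucc + (ρ + 2 * φ) * uch + φ * uhh := ⟨_, rfl⟩
  have hS0 : 0 < S := by
    rw [← neg_div, div_lt_iff₀ hp] at huch_lo
    linarith
  have hS1 : 4 * φ * S < -(ρ ^ 2 * ucc) := by
    have e : -(ρ ^ 2 * ucc) / (4 * φ * (ρ + 2 * φ)) - ((φ + ρ) * ucc + φ * uhh) / (ρ + 2 * φ)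
        = (-(ρ ^ 2 * ucc) - 4 * φ * ((φ + ρ) * ucc + φ * uhh)) / (4 * φ * (ρ + 2 * φ)) := by
      field_simp
    rw [e, lt_div_iff₀ (by positivity)] at huch_hi
    rw [hS]
    linarith
  obtain ⟨D, hD⟩ : ∃ D, D = -(φ / ucc) * S := ⟨_, rfl⟩
  have hDu : D * ucc = -(φ * S) := by
    rw [hD]
    field_simp
  have hφS : 0 < φ * S := by positivity
  have hD0 : 0 < D := by
    by_contra h
    nlinarith [mul_nonneg_of_nonpos_of_nonpos (not_lt.mp h) hucc.le]
  have hD1 : 0 < ρ ^ 2 - 4 * D := by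
    by_contra h
    nlinarith [mul_nonneg_of_nonpos_of_nonpos (not_lt.mp h) hucc.le]
  have hs := Real.sq_sqrt hD1.le
  have hlt : Real.sqrt (ρ ^ 2 - 4 * D) < ρ := by
    rw [Real.sqrt_lt' hρ]
    linarith
  have hnn := Real.sqrt_nonneg (ρ ^ 2 - 4 * D)
  generalize Real.sqrt (ρ ^ 2 - 4 * D) = s at hs hlt hnn
  refine ⟨(ρ + s) / 2, (ρ - s) / 2, ?_, by linarith, by linarith⟩
  have ht : (lockdownMatrix φ ρ ucc uhh uch).trace = (ρ + s) / 2 + (ρ - s) / 2 := by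
    rw [Matrix.trace_fin_two]
    simp [lockdownMatrix]
    ring
  have hd : (lockdownMatrix φ ρ ucc uhh uch).det = (ρ + s) / 2 * ((ρ - s) / 2) := by
    have h1 : (ρ + s) / 2 * ((ρ - s) / 2) = D := by linarith
    rw [h1, hD, hS, Matrix.det_fin_two]
    simp [lockdownMatrix]
    field_simp
    ring
  rw [Matrix.charpoly_fin_two, ht, hd, C_add, C_mul]
  ring
end

section
/- Let A be the 2×2 real matrix A = [[(1 + u_ch/u_cc)·φ + ρ, (u_ch² − u_cc·u_hh)/u_cc], [−φ²/u_cc, −φ·(1 + u_ch/u_cc)]] with φ > 0, ρ > 0 and u_cc < 0, u_hh < 0, u_ch real. If u_ch > −ρ²·u_cc/(4φ·(ρ+2φ)) − [(φ+ρ)·u_cc + φ·u_hh]/(ρ+2φ), then the eigenvalues of A over the complex numbers form a conjugate pair of non-real numbers, each with real part ρ/2 > 0. -/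
open Polynomial

/-- If `u_ch` is above the upper threshold, the eigenvalues of the linearized dynamics
matrix over `ℂ` form a conjugate pair of non-real numbers, each with real part `ρ/2 > 0`. -/
theorem lockdownMatrix_complex_eigenvalues
    (φ ρ ucc uhh uch : ℝ) (hφ : 0 < φ) (hρ : 0 < ρ) (hucc : ucc < 0) (huhh : uhh < 0)
    (huch : uch > -(ρ ^ 2 * ucc) / (4 * φ * (ρ + 2 * φ))
        - ((φ + ρ) * ucc + φ * uhh) / (ρ + 2 * φ)) :
    ∃ z : ℂ, z.im ≠ 0 ∧ z.re = ρ / 2 ∧ 0 < z.re ∧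
      (lockdownMatrix φ ρ ucc uhh uch).charpoly.map (algebraMap ℝ ℂ)
        = (X - C z) * (X - C ((starRingEnd ℂ) z)) := by
  obtain ⟨d, hd⟩ : ∃ d, d = (lockdownMatrix φ ρ ucc uhh uch).det := ⟨_, rfl⟩
  have hne : ucc ≠ 0 := hucc.ne
  have hdet : d * (-ucc) = φ * ((φ + ρ) * ucc + (ρ + 2 * φ) * uch + φ * uhh) := by
    rw [hd, lockdownMatrix, Matrix.det_fin_two_of]
    field_simp
    ring
  have htr : (lockdownMatrix φ ρ ucc uhh uch).trace = ρ := by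
    rw [lockdownMatrix, Matrix.trace_fin_two_of]
    ring
  have hp : 0 < ρ + 2 * φ := by positivity
  have hS : -(ρ ^ 2 * ucc) / 4 < φ * ((φ + ρ) * ucc + (ρ + 2 * φ) * uch + φ * uhh) := by
    have h1 := mul_lt_mul_of_pos_left huch (mul_pos hφ hp)
    have h2 : φ * (ρ + 2 * φ) * (-(ρ ^ 2 * ucc) / (4 * φ * (ρ + 2 * φ))
        - ((φ + ρ) * ucc + φ * uhh) / (ρ + 2 * φ))
        = -(ρ ^ 2 * ucc) / 4 - φ * ((φ + ρ) * ucc + φ * uhh) := by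
      field_simp
    rw [h2] at h1
    linarith
  have hpos : 0 < d - ρ ^ 2 / 4 := by
    by_contra hcon
    nlinarith
  have hs : Real.sqrt (d - ρ ^ 2 / 4) ^ 2 = d - ρ ^ 2 / 4 := Real.sq_sqrt hpos.le
  have hs0 : 0 < Real.sqrt (d - ρ ^ 2 / 4) := Real.sqrt_pos.mpr hpos
  generalize Real.sqrt (d - ρ ^ 2 / 4) = s at hs hs0
  refine ⟨⟨ρ / 2, s⟩, hs0.ne', rfl, half_pos hρ, ?_⟩
  rw [Matrix.charpoly_fin_two, htr, ← hd]
  have e1 : (⟨ρ / 2, s⟩ : ℂ) + (starRingEnd ℂ) ⟨ρ / 2, s⟩ = (ρ : ℂ) := by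
    apply Complex.ext <;> simp
  have e2 : (⟨ρ / 2, s⟩ : ℂ) * (starRingEnd ℂ) ⟨ρ / 2, s⟩ = (d : ℂ) := by
    apply Complex.ext
    · simp
      linarith
    · simp
      ring
  generalize (⟨ρ / 2, s⟩ : ℂ) = z at e1 e2
  simp only [Polynomial.map_add, Polynomial.map_sub, Polynomial.map_mul, Polynomial.map_pow,
    Polynomial.map_X, Polynomial.map_C, Complex.coe_algebraMap, ← e1, ← e2, C_add, C_mul]
  ring
end

section
/- Let φ > 0, ρ > 0, u_cc < 0, u_hh < 0, u_ch be reals, and let ψ₁ < 0 be a real number satisfying ψ₁² − ρ·ψ₁ + (−(φ/u_cc)·[(φ+ρ)·u_cc + (ρ+2φ)·u_ch + φ·u_hh]) = 0 (i.e., ψ₁ is a real eigenvalue of A). For any real h₀, define h(t) = h₀·e^{ψ₁t} and μ(t) = −[(φ·u_ch + (φ+ψ₁)·u_cc)/φ²]·h(t). Then for all t ∈ ℝ: μ'(t) = [(1 + u_ch/u_cc)·φ + ρ]·μ(t) + [(u_ch² − u_cc·u_hh)/u_cc]·h(t) and h'(t) = −(φ²/u_cc)·μ(t) − φ·(1 +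 u_ch/u_cc)·h(t); moreover the transversality condition lim_{t→∞} h(t)·μ(t)·e^{−ρt} = 0 holds. -/
open Real Filter

/-- The candidate path `h(t) = h₀·e^{ψ₁t}`, `μ(t) = −[(φ·u_ch + (φ+ψ₁)·u_cc)/φ²]·h(t)`
solves the linearized habit–costate ODE system and satisfies the transversality
condition, whenever `ψ₁ < 0` is a real eigenvalue of the dynamics matrix. -/
theorem habit_costate_solution
    (φ ρ ucc uhh uch ψ₁ h₀ : ℝ) (hφ : 0 < φ) (hρ : 0 < ρ)
    (hucc : ucc < 0) (huhh : uhh < 0) (hψ₁ : ψ₁ < 0)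
    (hroot : ψ₁ ^ 2 - ρ * ψ₁
      + (-(φ / ucc) * ((φ + ρ) * ucc + (ρ + 2 * φ) * uch + φ * uhh)) = 0) :
    (∀ t : ℝ,
      HasDerivAt (fun t : ℝ => -((φ * uch + (φ + ψ₁) * ucc) / φ ^ 2) * (h₀ * exp (ψ₁ * t)))
        (((1 + uch / ucc) * φ + ρ)
            * (-((φ * uch + (φ + ψ₁) * ucc) / φ ^ 2) * (h₀ * exp (ψ₁ * t)))
          + ((uch ^ 2 - ucc * uhh) / ucc) * (h₀ * exp (ψ₁ * t))) t ∧
      HasDerivAt (fun t : ℝ => h₀ * exp (ψ₁ * t))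
        (-(φ ^ 2 / ucc)
            * (-((φ * uch + (φ + ψ₁) * ucc) / φ ^ 2) * (h₀ * exp (ψ₁ * t)))
          - φ * (1 + uch / ucc) * (h₀ * exp (ψ₁ * t))) t) ∧
    Tendsto
      (fun t : ℝ => (h₀ * exp (ψ₁ * t))
        * (-((φ * uch + (φ + ψ₁) * ucc) / φ ^ 2) * (h₀ * exp (ψ₁ * t)))
        * exp (-ρ * t))
      atTop (nhds 0) := by
  have hφ' : φ ≠ 0 := hφ.ne'
  have hu : ucc ≠ 0 := hucc.ne
  have hd : ∀ t : ℝ, HasDerivAt (fun t : ℝ => h₀ * exp (ψ₁ * t))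
      (ψ₁ * (h₀ * exp (ψ₁ * t))) t := by
    intro t
    have h := ((((hasDerivAt_id t).const_mul ψ₁).exp).const_mul h₀)
    refine HasDerivAt.congr_deriv h ?_
    simp only [id, mul_one]
    ring
  have e1 : -((φ * uch + (φ + ψ₁) * ucc) / φ ^ 2) * ψ₁
      = ((1 + uch / ucc) * φ + ρ) * (-((φ * uch + (φ + ψ₁) * ucc) / φ ^ 2))
        + (uch ^ 2 - ucc * uhh) / ucc := by
    rw [← sub_eq_zero]
    have h2 := congrArg (fun x => -(ucc / φ ^ 2) * x) hroot
    simp only [mul_zero] at h2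
    rw [← h2]
    field_simp
    ring
  have e2 : ψ₁ = -(φ ^ 2 / ucc) * (-((φ * uch + (φ + ψ₁) * ucc) / φ ^ 2))
      - φ * (1 + uch / ucc) := by
    field_simp
    ring
  refine ⟨fun t => ⟨?_, ?_⟩, ?_⟩
  · refine ((hd t).const_mul (-((φ * uch + (φ + ψ₁) * ucc) / φ ^ 2))).congr_deriv ?_
    linear_combination (h₀ * exp (ψ₁ * t)) * e1
  · refine (hd t).congr_deriv ?_
    linear_combination (h₀ * exp (ψ₁ * t)) * e2
  · have hT : Tendsto (fun t : ℝ => exp ((2 * ψ₁ - ρ) * t)) atTop (nhds 0) :=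
      tendsto_exp_atBot.comp (tendsto_id.const_mul_atTop_of_neg (by linarith))
    have h3 := hT.const_mul (h₀ * -((φ * uch + (φ + ψ₁) * ucc) / φ ^ 2) * h₀)
    rw [mul_zero] at h3
    refine h3.congr fun t => ?_
    have : exp ((2 * ψ₁ - ρ) * t) = exp (ψ₁ * t) * exp (ψ₁ * t) * exp (-ρ * t) := by
      rw [← exp_add, ← exp_add]
      congr 1
      ring
    rw [this]
    ring
end

section
/- Let r = ρ > 0 and φ > 0 be reals, ψ₁ a real with ψ₁ ≠ 0, ψ₁ ≠ r, φ + r ≠ 0, φ + ρ ≠ 0, and let a_{c₁}, a_h, a_{c₁c₁}, a_{hh}, a_{c₁h}, a_{c₁c₂}, a_{c₂h}, y₁, y₂, b₀, h₀ be real parameters. Define E := (φ+ρ)·a_{c₁c₁} + (ρ+2φ)·a_{c₁h} + φ·a_{hh}, C := φ·(ψ₁−r)/((φ+r)·ψ₁), D := r·(φ+ψ₁)/(φ·(ψ₁−r)), G := r·b₀ + y₁ + D·h₀, m₀ := a_{c₁} + (φ·a_h + [(φ+ρ)·a_{c₁c₂} + φ·a_{c₂h}]·y₂)/(φ+ρ),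 m₁ := C·E/(φ+ρ), λ := m₀ + m₁·G, h* := C·G, b* := (h* − y₁)/r, and μ* := (λ − a_{c₁} − (a_{c₁c₁}+a_{c₁h})·h* − a_{c₁c₂}·y₂)/φ. Then: (i) (φ+ρ)·μ* = a_h + (a_{hh}+a_{c₁h})·h* + a_{c₂h}·y₂, i.e., the steady-state costate equation for habits holds; and (ii) b₀ − b* = ((φ+ψ₁)/(φ·(r−ψ₁)))·(h₀ − h*), i.e., the saddle-path (transversality) condition determining λ holds. -/
/-- In the linear-quadratic two-sector habit economy, the steady-state quantities
defined from the parameters satisfy (i) the steady-state costate equation for habits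
and (ii) the saddle-path (transversality) condition determining `λ`. -/
theorem steady_state_identities
    (r ρ φ ψ₁ ac1 ah ac1c1 ahh ac1h ac1c2 ac2h y₁ y₂ b₀ h₀ : ℝ)
    (E C D G m₀ m₁ lam hstar bstar mustar : ℝ)
    (hrρ : r = ρ) (hρ : 0 < ρ) (hφ : 0 < φ)
    (hψ0 : ψ₁ ≠ 0) (hψr : ψ₁ ≠ r) (hφr : φ + r ≠ 0) (hφρ : φ + ρ ≠ 0)
    (hE : E = (φ + ρ) * ac1c1 + (ρ + 2 * φ) * ac1h + φ * ahh)
    (hC : C = φ * (ψ₁ - r) / ((φ + r) * ψ₁))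
    (hD : D = r * (φ + ψ₁) / (φ * (ψ₁ - r)))
    (hG : G = r * b₀ + y₁ + D * h₀)
    (hm₀ : m₀ = ac1 + (φ * ah + ((φ + ρ) * ac1c2 + φ * ac2h) * y₂) / (φ + ρ))
    (hm₁ : m₁ = C * E / (φ + ρ))
    (hlam : lam = m₀ + m₁ * G)
    (hhstar : hstar = C * G)
    (hbstar : bstar = (hstar - y₁) / r)
    (hmustar : mustar = (lam - ac1 - (ac1c1 + ac1h) * hstar - ac1c2 * y₂) / φ) :
    (φ + ρ) * mustar = ah + (ahh + ac1h) * hstar + ac2h * y₂ ∧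
    b₀ - bstar = ((φ + ψ₁) / (φ * (r - ψ₁))) * (h₀ - hstar) := by
  have hr : r ≠ 0 := by rw [hrρ]; exact hρ.ne'
  have hφ0 : φ ≠ 0 := hφ.ne'
  have h1 : ψ₁ - r ≠ 0 := sub_ne_zero.mpr hψr
  have h2 : r - ψ₁ ≠ 0 := sub_ne_zero.mpr hψr.symm
  constructor
  · have hl : lam = ac1 + (φ * ah + ((φ + ρ) * ac1c2 + φ * ac2h) * y₂) / (φ + ρ)
        + hstar * E / (φ + ρ) := by
      rw [hlam, hm₀, hm₁, hhstar]; ring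
    rw [hmustar, hl, hE]
    field_simp
    ring
  · have hCD : C * (1 + D) = 1 := by
      rw [hC, hD]
      field_simp
      ring
    have hGh : G = hstar * (1 + D) := by
      rw [hhstar]; linear_combination (-G) * hCD
    have hK : (φ + ψ₁) / (φ * (r - ψ₁)) = -D / r := by
      have h3 : r - ψ₁ = -(ψ₁ - r) := by ring
      rw [hD, h3]
      field_simp
    rw [hK, hbstar]
    field_simp
    linear_combination hGh - hG
end

section
/- Let φ > 0, λ > 0, ψ₁ < 0 be reals, a_{c₂c₁}, a_{c₂h}, p* reals, and h₀ < h* < h*_L reals. Define SSE := ((φ+ψ₁)·a_{c₂c₁} + φ·a_{c₂h})/(φ·λ), p_NL(t) := p* + SSE·(h₀ − h*)·e^{ψ₁t}, p_AL(t) := p* + SSE·[h*_L − h* + (h₀ − h*_L)·e^{ψ₁·t̃}]·e^{ψ₁(t−t̃)}, and t̲ := (ln(h*_L − h₀) − ln(h*_L − h*))/(−ψ₁). If (φ+ψ₁)·a_{c₂c₁} + φ·a_{c₂h} < 0 (satiation dominates substitutability) and t̃ > t̲, then for all t ≥ t̃: p_AL(t) < p* < p_NL(t). -/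
open Real

/-- If satiation dominates the substitutability effect and the lockdown is
sufficiently long, then after the lockdown the price of good 2 stays below the
steady-state price, which in turn lies below the no-lockdown price path. -/
theorem price_long_lockdown_satiation
    (φ lam ψ₁ a21 a2h pstar h₀ hstar hstarL ttilde : ℝ)
    (hφ : 0 < φ) (hlam : 0 < lam) (hψ₁ : ψ₁ < 0)
    (hh₀ : h₀ < hstar) (hhL : hstar < hstarL)
    (hsat : (φ + ψ₁) * a21 + φ * a2h < 0)
    (ht : ttilde > (Real.log (hstarL - h₀) - Real.log (hstarL - hstar)) / (-ψ₁)) :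
    ∀ t ≥ ttilde,
      pstar + ((φ + ψ₁) * a21 + φ * a2h) / (φ * lam)
          * (hstarL - hstar + (h₀ - hstarL) * exp (ψ₁ * ttilde)) * exp (ψ₁ * (t - ttilde))
        < pstar ∧
      pstar < pstar + ((φ + ψ₁) * a21 + φ * a2h) / (φ * lam)
          * (h₀ - hstar) * exp (ψ₁ * t) := by
  intro t _
  have hS : ((φ + ψ₁) * a21 + φ * a2h) / (φ * lam) < 0 :=
    div_neg_of_neg_of_pos hsat (mul_pos hφ hlam)
  have hA : 0 < hstarL - h₀ := by linarith
  have hB : 0 < hstarL - hstar := by linarith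
  have h1 := (div_lt_iff₀ (neg_pos.mpr hψ₁)).mp ht
  have h2 : Real.log (hstarL - h₀) + ψ₁ * ttilde < Real.log (hstarL - hstar) := by
    linarith
  have h3 := Real.exp_lt_exp.mpr h2
  rw [Real.exp_add, Real.exp_log hA, Real.exp_log hB] at h3
  have h4 : 0 < hstarL - hstar + (h₀ - hstarL) * exp (ψ₁ * ttilde) := by linarith
  have h5 := mul_neg_of_neg_of_pos (mul_neg_of_neg_of_pos hS h4)
    (Real.exp_pos (ψ₁ * (t - ttilde)))
  have h6 := mul_pos (mul_pos_of_neg_of_neg hS (sub_neg.mpr hh₀)) (Real.exp_pos (ψ₁ * t))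
  exact ⟨by linarith, by linarith⟩
end

section
/- Let φ > 0, λ > 0, ψ₁ < 0 be reals, a_{c₂c₁}, a_{c₂h}, p* reals, and h₀ < h* < h*_L reals. Define SSE := ((φ+ψ₁)·a_{c₂c₁} + φ·a_{c₂h})/(φ·λ), p_NL(t) := p* + SSE·(h₀ − h*)·e^{ψ₁t}, p_AL(t) := p* + SSE·[h*_L − h* + (h₀ − h*_L)·e^{ψ₁·t̃}]·e^{ψ₁(t−t̃)}, and t̲ := (ln(h*_L − h₀) − ln(h*_L − h*))/(−ψ₁). If (φ+ψ₁)·a_{c₂c₁} + φ·a_{c₂h} < 0 (satiation dominates substitutability) and 0 < t̃ < t̲, then for all t ≥ t̃: p* < p_AL(t) < p_NL(t). -/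
open Real

/-- If satiation dominates the substitutability effect and the lockdown is
sufficiently short, then after the lockdown the price of good 2 lies strictly
between the steady-state price and the no-lockdown price path. -/
theorem price_short_lockdown_satiation
    (φ lam ψ₁ a21 a2h pstar h₀ hstar hstarL ttilde : ℝ)
    (hφ : 0 < φ) (hlam : 0 < lam) (hψ₁ : ψ₁ < 0)
    (hh₀ : h₀ < hstar) (hhL : hstar < hstarL)
    (hsat : (φ + ψ₁) * a21 + φ * a2h < 0)
    (ht0 : 0 < ttilde)
    (ht : ttilde < (Real.log (hstarL - h₀) - Real.log (hstarL - hstar)) / (-ψ₁)) :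
    ∀ t ≥ ttilde,
      pstar < pstar + ((φ + ψ₁) * a21 + φ * a2h) / (φ * lam)
          * (hstarL - hstar + (h₀ - hstarL) * exp (ψ₁ * ttilde)) * exp (ψ₁ * (t - ttilde)) ∧
      pstar + ((φ + ψ₁) * a21 + φ * a2h) / (φ * lam)
          * (hstarL - hstar + (h₀ - hstarL) * exp (ψ₁ * ttilde)) * exp (ψ₁ * (t - ttilde))
        < pstar + ((φ + ψ₁) * a21 + φ * a2h) / (φ * lam)
          * (h₀ - hstar) * exp (ψ₁ * t) := by
  intro t _
  have hS : ((φ + ψ₁) * a21 + φ * a2h) / (φ * lam) < 0 :=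
    div_neg_of_neg_of_pos hsat (mul_pos hφ hlam)
  generalize ((φ + ψ₁) * a21 + φ * a2h) / (φ * lam) = S at hS ⊢
  have hE1 : exp (ψ₁ * ttilde) < 1 :=
    Real.exp_lt_one_iff.mpr (mul_neg_of_neg_of_pos hψ₁ ht0)
  have hA : 0 < hstarL - hstar := by linarith
  have hC : 0 < hstarL - h₀ := by linarith
  rw [lt_div_iff₀ (by linarith)] at ht
  have hB : hstarL - hstar < (hstarL - h₀) * exp (ψ₁ * ttilde) := by
    rw [← Real.log_lt_log_iff hA (mul_pos hC (Real.exp_pos _)),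
      Real.log_mul hC.ne' (Real.exp_pos _).ne', Real.log_exp]
    linarith
  have hsplit : exp (ψ₁ * t) = exp (ψ₁ * ttilde) * exp (ψ₁ * (t - ttilde)) := by
    rw [← Real.exp_add]
    congr 1
    ring
  rw [hsplit]
  have hF : 0 < exp (ψ₁ * (t - ttilde)) := Real.exp_pos _
  generalize exp (ψ₁ * (t - ttilde)) = F at hF ⊢
  generalize exp (ψ₁ * ttilde) = E at hE1 hB ⊢
  constructor
  · have h1 : hstarL - hstar + (h₀ - hstarL) * E < 0 := by linarith
    have := mul_pos (mul_pos_of_neg_of_neg hS h1) hF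
    linarith
  · have h2 := mul_pos (mul_pos (neg_pos.mpr hS) (mul_pos hA (sub_pos.mpr hE1))) hF
    linarith
end

section
/- Let φ > 0, λ > 0, ψ₁ < 0 be reals, a_{c₂c₁}, a_{c₂h}, p* reals, and h₀ < h* < h*_L reals. Define SSE := ((φ+ψ₁)·a_{c₂c₁} + φ·a_{c₂h})/(φ·λ), p_NL(t) := p* + SSE·(h₀ − h*)·e^{ψ₁t}, p_AL(t) := p* + SSE·[h*_L − h* + (h₀ − h*_L)·e^{ψ₁·t̃}]·e^{ψ₁(t−t̃)}, and t̲ := (ln(h*_L − h₀) − ln(h*_L − h*))/(−ψ₁). If (φ+ψ₁)·a_{c₂c₁} + φ·a_{c₂h} > 0 (substitutability dominates satiation) and t̃ > t̲, then for all t ≥ t̃: p_AL(t) > p* > p_NL(t). -/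
open Real

/-- If substitutability dominates the satiation effect and the lockdown is
sufficiently long, then after the lockdown the price of good 2 stays above the
steady-state price, which in turn lies above the no-lockdown price path. -/
theorem price_long_lockdown_substitutability
    (φ lam ψ₁ a21 a2h pstar h₀ hstar hstarL ttilde : ℝ)
    (hφ : 0 < φ) (hlam : 0 < lam) (hψ₁ : ψ₁ < 0)
    (hh₀ : h₀ < hstar) (hhL : hstar < hstarL)
    (hsub : (φ + ψ₁) * a21 + φ * a2h > 0)
    (ht : ttilde > (Real.log (hstarL - h₀) - Real.log (hstarL - hstar)) / (-ψ₁)) :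
    ∀ t ≥ ttilde,
      pstar + ((φ + ψ₁) * a21 + φ * a2h) / (φ * lam)
          * (hstarL - hstar + (h₀ - hstarL) * exp (ψ₁ * ttilde)) * exp (ψ₁ * (t - ttilde))
        > pstar ∧
      pstar > pstar + ((φ + ψ₁) * a21 + φ * a2h) / (φ * lam)
          * (h₀ - hstar) * exp (ψ₁ * t) := by
  intro t _
  have hS : 0 < ((φ + ψ₁) * a21 + φ * a2h) / (φ * lam) := div_pos hsub (mul_pos hφ hlam)
  have hA : 0 < hstarL - hstar := by linarith
  have hB : 0 < hstarL - h₀ := by linarith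
  have h1 : Real.log (hstarL - h₀) - Real.log (hstarL - hstar) < ttilde * (-ψ₁) :=
    (div_lt_iff₀ (by linarith)).1 ht
  have h2 : (hstarL - h₀) * exp (ψ₁ * ttilde) < hstarL - hstar := by
    calc (hstarL - h₀) * exp (ψ₁ * ttilde)
        = exp (Real.log (hstarL - h₀) + ψ₁ * ttilde) := by rw [exp_add, exp_log hB]
      _ < exp (Real.log (hstarL - hstar)) := exp_lt_exp.2 (by linarith)
      _ = hstarL - hstar := exp_log hA
  have h3 : 0 < hstarL - hstar + (h₀ - hstarL) * exp (ψ₁ * ttilde) := by linarith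
  have h4 := mul_pos (mul_pos hS h3) (exp_pos (ψ₁ * (t - ttilde)))
  have h5 := mul_neg_of_neg_of_pos
    (mul_neg_of_pos_of_neg hS (sub_neg.2 hh₀)) (exp_pos (ψ₁ * t))
  exact ⟨lt_add_of_pos_right _ h4, add_lt_of_neg_right _ h5⟩
end

section
/- Let φ > 0, λ > 0, ψ₁ < 0 be reals, a_{c₂c₁}, a_{c₂h}, p* reals, and h₀ < h* < h*_L reals. Define SSE := ((φ+ψ₁)·a_{c₂c₁} + φ·a_{c₂h})/(φ·λ), p_NL(t) := p* + SSE·(h₀ − h*)·e^{ψ₁t}, p_AL(t) := p* + SSE·[h*_L − h* + (h₀ − h*_L)·e^{ψ₁·t̃}]·e^{ψ₁(t−t̃)}, and t̲ := (ln(h*_L − h₀) − ln(h*_L − h*))/(−ψ₁). If (φ+ψ₁)·a_{c₂c₁} + φ·a_{c₂h} > 0 (substitutability dominates satiation) and 0 < t̃ < t̲, then for all t ≥ t̃: p* > p_AL(t) > p_NL(t). -/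
open Real

/-- If substitutability dominates the satiation effect and the lockdown is
sufficiently short, then after the lockdown the price of good 2 lies strictly
between the no-lockdown price path and the steady-state price. -/
theorem price_short_lockdown_substitutability
    (φ lam ψ₁ a21 a2h pstar h₀ hstar hstarL ttilde : ℝ)
    (hφ : 0 < φ) (hlam : 0 < lam) (hψ₁ : ψ₁ < 0)
    (hh₀ : h₀ < hstar) (hhL : hstar < hstarL)
    (hsub : (φ + ψ₁) * a21 + φ * a2h > 0)
    (ht0 : 0 < ttilde)
    (ht : ttilde < (Real.log (hstarL - h₀) - Real.log (hstarL - hstar)) / (-ψ₁)) :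
    ∀ t ≥ ttilde,
      pstar > pstar + ((φ + ψ₁) * a21 + φ * a2h) / (φ * lam)
          * (hstarL - hstar + (h₀ - hstarL) * exp (ψ₁ * ttilde)) * exp (ψ₁ * (t - ttilde)) ∧
      pstar + ((φ + ψ₁) * a21 + φ * a2h) / (φ * lam)
          * (hstarL - hstar + (h₀ - hstarL) * exp (ψ₁ * ttilde)) * exp (ψ₁ * (t - ttilde))
        > pstar + ((φ + ψ₁) * a21 + φ * a2h) / (φ * lam)
          * (h₀ - hstar) * exp (ψ₁ * t) := by
  intro t _
  have hS : 0 < ((φ + ψ₁) * a21 + φ * a2h) / (φ * lam) := div_pos hsub (mul_pos hφ hlam)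
  generalize ((φ + ψ₁) * a21 + φ * a2h) / (φ * lam) = S at hS ⊢
  have hE : exp (ψ₁ * t) = exp (ψ₁ * ttilde) * exp (ψ₁ * (t - ttilde)) := by
    rw [← Real.exp_add]; congr 1; ring
  have hF : 0 < exp (ψ₁ * (t - ttilde)) := Real.exp_pos _
  have he1 : exp (ψ₁ * ttilde) < 1 := by
    rw [Real.exp_lt_one_iff]; exact mul_neg_of_neg_of_pos hψ₁ ht0
  have hb : hstarL - hstar < (hstarL - h₀) * exp (ψ₁ * ttilde) := by
    have h1 : 0 < hstarL - hstar := by linarith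
    have h2 : 0 < hstarL - h₀ := by linarith
    rw [lt_div_iff₀ (by linarith)] at ht
    rw [← Real.log_lt_log_iff h1 (by positivity), Real.log_mul h2.ne' (Real.exp_pos _).ne',
      Real.log_exp]
    linarith
  rw [hE]
  generalize exp (ψ₁ * (t - ttilde)) = F at *
  generalize exp (ψ₁ * ttilde) = e at *
  have hSF : 0 < S * F := mul_pos hS hF
  constructor
  · have := mul_pos hSF (sub_pos.2 hb)
    linarith
  · have := mul_pos hSF (mul_pos (sub_pos.2 hhL) (sub_pos.2 he1))
    linarith
end

section
/- Let φ > 0, λ > 0, ψ₁ < 0 be reals, a_{c₂c₁}, a_{c₂h}, p* reals, and reals h₀, h*, h*_L with h* < h₀ and h* < h*_L. Define SSE := ((φ+ψ₁)·a_{c₂c₁} + φ·a_{c₂h})/(φ·λ), p_NL(t) := p* + SSE·(h₀ − h*)·e^{ψ₁t} and, for a lockdown length t̃ > 0, p_AL(t) := p* + SSE·[h*_L − h* + (h₀ − h*_L)·e^{ψ₁·t̃}]·e^{ψ₁(t−t̃)}. Then for every t̃ > 0 and every t ≥ t̃: if (φ+ψ₁)·a_{c₂c₁} + φ·a_{c₂h}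 < 0 then p_AL(t) < p_NL(t) < p*; and if (φ+ψ₁)·a_{c₂c₁} + φ·a_{c₂h} > 0 then p* < p_NL(t) < p_AL(t). -/
open Real

/-- When the initial habit stock starts above the no-lockdown steady state
(`h* < h₀`) and `h* < h*_L`, for every lockdown length `t̃ > 0` and every `t ≥ t̃`:
if satiation dominates then `p_AL(t) < p_NL(t) < p*`, and if substitutability
dominates then `p* < p_NL(t) < p_AL(t)`. -/
theorem price_high_initial_habits
    (φ lam ψ₁ a21 a2h pstar h₀ hstar hstarL : ℝ)
    (hφ : 0 < φ) (hlam : 0 < lam) (hψ₁ : ψ₁ < 0)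
    (hh₀ : hstar < h₀) (hhL : hstar < hstarL) :
    ∀ ttilde > (0 : ℝ), ∀ t ≥ ttilde,
      ((φ + ψ₁) * a21 + φ * a2h < 0 →
        pstar + ((φ + ψ₁) * a21 + φ * a2h) / (φ * lam)
            * (hstarL - hstar + (h₀ - hstarL) * exp (ψ₁ * ttilde)) * exp (ψ₁ * (t - ttilde))
          < pstar + ((φ + ψ₁) * a21 + φ * a2h) / (φ * lam)
            * (h₀ - hstar) * exp (ψ₁ * t) ∧
        pstar + ((φ + ψ₁) * a21 + φ * a2h) / (φ * lam)
            * (h₀ - hstar) * exp (ψ₁ * t) < pstar) ∧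
      ((φ + ψ₁) * a21 + φ * a2h > 0 →
        pstar < pstar + ((φ + ψ₁) * a21 + φ * a2h) / (φ * lam)
            * (h₀ - hstar) * exp (ψ₁ * t) ∧
        pstar + ((φ + ψ₁) * a21 + φ * a2h) / (φ * lam)
            * (h₀ - hstar) * exp (ψ₁ * t)
          < pstar + ((φ + ψ₁) * a21 + φ * a2h) / (φ * lam)
            * (hstarL - hstar + (h₀ - hstarL) * exp (ψ₁ * ttilde))
            * exp (ψ₁ * (t - ttilde))) := by
  intro T hT t ht
  have hE : exp (ψ₁ * T) < 1 := by
    rw [Real.exp_lt_one_iff]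
    exact mul_neg_of_neg_of_pos hψ₁ hT
  have hF : 0 < exp (ψ₁ * (t - T)) := exp_pos _
  have hG : 0 < exp (ψ₁ * t) := exp_pos _
  have hEF : exp (ψ₁ * t) = exp (ψ₁ * T) * exp (ψ₁ * (t - T)) := by
    rw [← exp_add]
    congr 1
    ring
  have hden : 0 < φ * lam := mul_pos hφ hlam
  have h1 : 0 < (h₀ - hstar) * exp (ψ₁ * t) := mul_pos (sub_pos.2 hh₀) hG
  have h2 : (h₀ - hstar) * exp (ψ₁ * t) <
      (hstarL - hstar + (h₀ - hstarL) * exp (ψ₁ * T)) * exp (ψ₁ * (t - T)) := by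
    have h3 := mul_pos (mul_pos (sub_pos.2 hhL) (sub_pos.2 hE)) hF
    rw [hEF]
    linarith
  simp only [mul_assoc (((φ + ψ₁) * a21 + φ * a2h) / (φ * lam))]
  refine ⟨fun hS => ?_, fun hS => ?_⟩
  · have hS' := div_neg_of_neg_of_pos hS hden
    have := mul_lt_mul_of_neg_left h2 hS'
    have := mul_neg_of_neg_of_pos hS' h1
    constructor <;> linarith
  · have hS' := div_pos hS hden
    have := mul_lt_mul_of_pos_left h2 hS'
    have := mul_pos hS' h1
    constructor <;> linarith
end

section
/- Let r = ρ > 0 and φ > 0 be reals and ψ₁ < 0. Let b₀, h₀ be reals, m₁ < 0, a_{c₂c₂} < 0, and a_{c₁}, a_h, a_{c₂}, a_{c₁c₂}, a_{c₂h} reals. Let y₁ < y_{1AL} and y_{2AL} < y₂ be reals. Define C := φ·(ψ₁−r)/((φ+r)·ψ₁), D := r·(φ+ψ₁)/(φ·(ψ₁−r)), F(z₁) := r·b₀ + z₁ + D·h₀, h*(z₁) := C·F(z₁), m₀(z₂) := a_{c₁} + (φ·a_h + [(φ+ρ)·a_{c₁c₂} + φ·a_{c₂h}]·z₂)/(φ+ρ),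 λ(z₁,z₂) := m₀(z₂) + m₁·F(z₁), and p*(z₁,z₂) := (a_{c₂} + a_{c₂c₂}·z₂ + (a_{c₁c₂}+a_{c₂h})·h*(z₁))/λ(z₁,z₂). Assume: either (a_{c₁c₂} > 0, a_{c₂h} > −a_{c₁c₂}, a_{c₂} > −a_{c₂c₂}·y₂) or (a_{c₁c₂} < 0, a_{c₂h} > −((φ+ρ)/φ)·a_{c₁c₂}, a_{c₂} > −a_{c₂c₂}·y₂); that λ(z₁,z₂) > 0 for all (z₁,z₂) ∈ [y₁, y_{1AL}] × [y_{2AL}, y₂]; that h*(y_{1AL}) > 0; and that m₀(y₂) > 0. Then p*(y_{1AL}, y_{2AL}) > p*(y₁, y₂); i.e., a permanent reallocation of labor from sector 2 to sector 1 strictly raises the steady-state relative price of good 2. -/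
/-- A permanent reallocation of labor from sector 2 to sector 1 (raising `y₁` to
`y_{1AL}` and lowering `y₂` to `y_{2AL}`) strictly raises the steady-state relative
price of good 2, under the stated sign conditions on the utility parameters. -/
theorem labor_reallocation_raises_price
    (r ρ φ ψ₁ b₀ h₀ m₁ ac1 ah ac2 ac2c2 ac1c2 ac2h y₁ y1AL y₂ y2AL C D : ℝ)
    (F hstar m₀ : ℝ → ℝ) (lam pstar : ℝ → ℝ → ℝ)
    (hrρ : r = ρ) (hr : 0 < r) (hφ : 0 < φ) (hψ₁ : ψ₁ < 0)
    (hm₁ : m₁ < 0) (hac2c2 : ac2c2 < 0)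
    (hy1 : y₁ < y1AL) (hy2 : y2AL < y₂)
    (hC : C = φ * (ψ₁ - r) / ((φ + r) * ψ₁))
    (hD : D = r * (φ + ψ₁) / (φ * (ψ₁ - r)))
    (hF : ∀ z, F z = r * b₀ + z + D * h₀)
    (hhstar : ∀ z, hstar z = C * F z)
    (hm₀ : ∀ z, m₀ z = ac1 + (φ * ah + ((φ + ρ) * ac1c2 + φ * ac2h) * z) / (φ + ρ))
    (hlam : ∀ z₁ z₂, lam z₁ z₂ = m₀ z₂ + m₁ * F z₁)
    (hpstar : ∀ z₁ z₂,
      pstar z₁ z₂ = (ac2 + ac2c2 * z₂ + (ac1c2 + ac2h) * hstar z₁) / lam z₁ z₂)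
    (hcase : (0 < ac1c2 ∧ ac2h > -ac1c2 ∧ ac2 > -ac2c2 * y₂) ∨
        (ac1c2 < 0 ∧ ac2h > -((φ + ρ) / φ) * ac1c2 ∧ ac2 > -ac2c2 * y₂))
    (hlampos : ∀ z₁ ∈ Set.Icc y₁ y1AL, ∀ z₂ ∈ Set.Icc y2AL y₂, 0 < lam z₁ z₂)
    (hhpos : 0 < hstar y1AL)
    (hm₀pos : 0 < m₀ y₂) :
    pstar y₁ y₂ < pstar y1AL y2AL := by
  subst hrρ
  have hCpos : 0 < C := by
    rw [hC]
    exact div_pos_of_neg_of_neg (mul_neg_of_pos_of_neg hφ (by linarith))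
      (mul_neg_of_pos_of_neg (by linarith) hψ₁)
  have hSK : 0 < ac1c2 + ac2h ∧ 0 < (φ + r) * ac1c2 + φ * ac2h ∧ 0 < ac2 + ac2c2 * y₂ := by
    rcases hcase with ⟨h1, h2, h3⟩ | ⟨h1, h2, h3⟩
    · have e1 : 0 < ac1c2 + ac2h := by linarith
      have e2 := mul_pos hφ e1
      have e3 := mul_pos hr h1
      exact ⟨e1, by linarith, by linarith⟩
    · have e1 := mul_lt_mul_of_pos_left h2 hφ
      have e2 : φ * (-((φ + r) / φ) * ac1c2) = -((φ + r) * ac1c2) := by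
        field_simp
      rw [e2] at e1
      have e3 := mul_neg_of_pos_of_neg hr h1
      have e4 : 0 < φ * (ac1c2 + ac2h) := by linarith
      exact ⟨pos_of_mul_pos_right e4 hφ.le, by linarith, by linarith⟩
  obtain ⟨hS, hK, hA⟩ := hSK
  have hl2 := hlampos y1AL ⟨hy1.le, le_rfl⟩ y2AL ⟨le_rfl, hy2.le⟩
  have hl1 := hlampos y₁ ⟨le_rfl, hy1.le⟩ y₂ ⟨hy2.le, le_rfl⟩
  have hFl : F y₁ < F y1AL := by rw [hF, hF]; linarith
  have hm : m₀ y2AL ≤ m₀ y₂ := by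
    rw [hm₀, hm₀]
    have hp : 0 < φ + r := by linarith
    gcongr
  have hle : lam y1AL y2AL ≤ lam y₁ y₂ := by
    rw [hlam, hlam]
    have := mul_lt_mul_of_neg_left hFl hm₁
    linarith
  have hh : hstar y₁ < hstar y1AL := by
    rw [hhstar, hhstar]
    exact mul_lt_mul_of_pos_left hFl hCpos
  have ha := mul_lt_mul_of_neg_left hy2 hac2c2
  have hb := mul_lt_mul_of_pos_left hh hS
  have hc := mul_pos hS hhpos
  rw [hpstar, hpstar]
  calc _ < (ac2 + ac2c2 * y2AL + (ac1c2 + ac2h) * hstar y1AL) / lam y₁ y₂ :=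
        div_lt_div_of_pos_right (by linarith) hl1
    _ ≤ _ := div_le_div_of_nonneg_left (by linarith) hl2 hle
end

section
/- Let φ > 0, ψ₁ < 0, λ_{NL} > 0, λ_{AL} > 0 be reals, and let a_{c₂c₁}, a_{c₂h}, h₀, h*_{NL}, h*_L, p*, p*_{AL} be reals with SSE := (φ+ψ₁)·a_{c₂c₁} + φ·a_{c₂h} < 0 (satiation dominates substitutability), h₀ > h*_L, h*_{NL} < h*_L, p*_{AL} > p*, and I := (h₀ − h*_L)·λ_{NL} − (h₀ − h*_{NL})·λ_{AL} > 0. Define p_{AL}(t̃) := p*_{AL} + SSE·(h₀ − h*_L)·e^{ψ₁·t̃}/(φ·λ_{AL}), p_{NL}(t̃) := p* + SSE·(h₀ − h*_{NL})·e^{ψ₁·t̃}/(φ·λ_{NL}), and t̲ := [ln((p*_{AL} − p*)·φ·λ_{NL}·λ_{AL}) − ln(−SSE·I)]/ψ₁. Then for every t̃, p_{AL}(t̃) < p_{NL}(t̃) if and only if t̃ < t̲. -/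
open Real

/-- With a permanent post-lockdown change in labor composition, when satiation
dominates substitutability, `h₀ > h*_L`, `p*_{AL} > p*` and `I > 0`, the reopening
price is below the counterfactual no-lockdown price if and only if the lockdown
is shorter than the threshold `t̲`. -/
theorem reopening_price_comparison
    (φ ψ₁ lamNL lamAL a21 a2h h₀ hNL hL pstar pstarAL ttilde : ℝ)
    (hφ : 0 < φ) (hψ₁ : ψ₁ < 0) (hlamNL : 0 < lamNL) (hlamAL : 0 < lamAL)
    (hSSE : (φ + ψ₁) * a21 + φ * a2h < 0)
    (hh₀ : h₀ > hL) (hNLL : hNL < hL) (hp : pstarAL > pstar)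
    (hI : 0 < (h₀ - hL) * lamNL - (h₀ - hNL) * lamAL) :
    pstarAL + ((φ + ψ₁) * a21 + φ * a2h) * (h₀ - hL) * exp (ψ₁ * ttilde) / (φ * lamAL)
        < pstar + ((φ + ψ₁) * a21 + φ * a2h) * (h₀ - hNL) * exp (ψ₁ * ttilde) / (φ * lamNL)
      ↔ ttilde <
        (Real.log ((pstarAL - pstar) * φ * lamNL * lamAL)
          - Real.log (-(((φ + ψ₁) * a21 + φ * a2h)
              * ((h₀ - hL) * lamNL - (h₀ - hNL) * lamAL)))) / ψ₁ := by
  generalize (φ + ψ₁) * a21 + φ * a2h = S at *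
  have hA : 0 < (pstarAL - pstar) * φ * lamNL * lamAL := by
    have : 0 < pstarAL - pstar := by linarith
    positivity
  have hB : 0 < -(S * ((h₀ - hL) * lamNL - (h₀ - hNL) * lamAL)) := by
    have := mul_neg_of_neg_of_pos hSSE hI
    linarith
  have hD : 0 < φ * lamNL * lamAL := by positivity
  have key : (pstar + S * (h₀ - hNL) * exp (ψ₁ * ttilde) / (φ * lamNL))
      - (pstarAL + S * (h₀ - hL) * exp (ψ₁ * ttilde) / (φ * lamAL))
      = (-(S * ((h₀ - hL) * lamNL - (h₀ - hNL) * lamAL)) * exp (ψ₁ * ttilde)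
        - (pstarAL - pstar) * φ * lamNL * lamAL) / (φ * lamNL * lamAL) := by
    field_simp
    ring
  rw [← sub_pos, key, div_pos_iff_of_pos_right hD, sub_pos,
    ← Real.log_lt_log_iff hA (mul_pos hB (exp_pos _)),
    Real.log_mul hB.ne' (exp_pos _).ne', Real.log_exp, lt_div_iff_of_neg hψ₁]
  constructor <;> intro h <;> linarith
end
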